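/- Let ν ≥ 0 be a real number and define Ber_ν(t) = ∑_{n=0}^∞ cos((3ν+2n)π/4) · f_{n,ν}(t) and Bei_ν(t) = ∑_{n=0}^∞ sin((3ν+2n)π/4) · f_{n,ν}(t) for t > 0. Then for all t > 0, (L_ν Ber_ν)(t) = −Bei_ν(t). (Equivalently, the left shift of the coefficient sequence {cos((3ν+2n)π/4)} is {−sin((3ν+2n)π/4)}.) -/

import Mathlib

open Real

/-- The monomial `f_{n,ν}(t) = (t/2)^(2n+ν) / (Γ(ν+n+1)·n!)`. -/
noncomputable def besselMonomial (ν : ℝ) (n : ℕ) (t : ℝ) : ℝ :=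
  (t / 2) ^ (2 * (n : ℝ) + ν) / (Real.Gamma (ν + n + 1) * n.factorial)

/-- The Bessel operator `L_ν f (t) = f''(t) + f'(t)/t − (ν²/t²) f(t)`. -/
noncomputable def besselOp (ν : ℝ) (f : ℝ → ℝ) (t : ℝ) : ℝ :=
  deriv (deriv f) t + deriv f t / t - (ν ^ 2 / t ^ 2) * f t

/-- Kelvin function `Ber_ν(t) = ∑ cos((3ν+2n)π/4) f_{n,ν}(t)`. -/
noncomputable def kelvinBer (ν : ℝ) (t : ℝ) : ℝ :=
  ∑' n : ℕ, Real.cos ((3 * ν + 2 * n) * π / 4) * besselMonomial ν n t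

/-- Kelvin function `Bei_ν(t) = ∑ sin((3ν+2n)π/4) f_{n,ν}(t)`. -/
noncomputable def kelvinBei (ν : ℝ) (t : ℝ) : ℝ :=
  ∑' n : ℕ, Real.sin ((3 * ν + 2 * n) * π / 4) * besselMonomial ν n t

/-- The series `∑ aₙ f_{n,ν}(t)` with coefficient sequence `a`. -/
noncomputable def besselSeries (ν : ℝ) (a : ℕ → ℝ) (t : ℝ) : ℝ :=
  ∑' n : ℕ, a n * besselMonomial ν n t

lemma Gamma_add_nat_add_one_pos {ν : ℝ} (hν : 0 ≤ ν) (n : ℕ) : 0 < Real.Gamma (ν + n + 1) :=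
  Real.Gamma_pos_of_pos (by positivity)

lemma besselMonomial_nonneg {ν : ℝ} (hν : 0 ≤ ν) (n : ℕ) {t : ℝ} (ht : 0 < t) :
    0 ≤ besselMonomial ν n t := by
  have := Gamma_add_nat_add_one_pos hν n
  unfold besselMonomial
  positivity

lemma besselMonomial_le {ν : ℝ} (hν : 0 ≤ ν) (n : ℕ) {s t : ℝ} (hs : 0 < s) (hst : s ≤ t) :
    besselMonomial ν n s ≤ besselMonomial ν n t := by
  have := Gamma_add_nat_add_one_pos hν n
  unfold besselMonomial
  gcongr

lemma Gamma_add_one_le_Gamma_add_nat {ν : ℝ} (hν : 0 ≤ ν) (n : ℕ) :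
    Real.Gamma (ν + 1) ≤ Real.Gamma (ν + n + 1) := by
  induction n with
  | zero => simp
  | succ n ih =>
    have hpos := Gamma_add_nat_add_one_pos hν n
    have hrec : Real.Gamma (ν + n + 1 + 1) = (ν + n + 1) * Real.Gamma (ν + n + 1) :=
      Real.Gamma_add_one (by positivity)
    have hn : (0 : ℝ) ≤ n := n.cast_nonneg
    rw [Nat.cast_succ, ← add_assoc, hrec]
    nlinarith [mul_nonneg (add_nonneg hν hn) hpos.le]

lemma summable_besselMonomial {ν : ℝ} (hν : 0 ≤ ν) {t : ℝ} (ht : 0 < t) :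
    Summable fun n => besselMonomial ν n t := by
  have h0 : 0 < Real.Gamma (ν + 1) := Real.Gamma_pos_of_pos (by positivity)
  refine Summable.of_nonneg_of_le (fun n => besselMonomial_nonneg hν n ht) (fun n => ?_)
    ((Real.summable_pow_div_factorial ((t / 2) ^ 2)).mul_left ((t / 2) ^ ν / Real.Gamma (ν + 1)))
  have hpow : (t / 2) ^ (2 * (n : ℝ) + ν) = (t / 2) ^ ν * ((t / 2) ^ 2) ^ n := by
    rw [Real.rpow_add (by positivity), ← pow_mul, mul_comm, ← Real.rpow_natCast]
    push_cast
    rfl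
  rw [besselMonomial, hpow, div_mul_div_comm]
  gcongr
  exact Gamma_add_one_le_Gamma_add_nat hν n

lemma pow_mul_besselMonomial_le {ν : ℝ} (hν : 0 ≤ ν) (k n : ℕ) {t : ℝ} (ht : 0 < t) :
    (2 * (n : ℝ) + ν) ^ k * besselMonomial ν n t ≤
      k.factorial * besselMonomial ν n (Real.exp 1 * t) := by
  have hG := Gamma_add_nat_add_one_pos hν n
  have hexp : (2 * (n : ℝ) + ν) ^ k ≤ k.factorial * Real.exp (2 * n + ν) := by
    have := Real.pow_div_factorial_le_exp (2 * (n : ℝ) + ν) (by positivity) k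
    rwa [div_le_iff₀' (by positivity)] at this
  have hscale : besselMonomial ν n (Real.exp 1 * t) =
      Real.exp (2 * n + ν) * besselMonomial ν n t := by
    rw [besselMonomial, besselMonomial, mul_div_assoc (Real.exp 1),
      Real.mul_rpow (by positivity) (by positivity), Real.exp_one_rpow, mul_div_assoc]
  rw [hscale, ← mul_assoc]
  exact mul_le_mul_of_nonneg_right hexp (besselMonomial_nonneg hν n ht)

lemma summable_pow_mul_besselMonomial {ν : ℝ} (hν : 0 ≤ ν) (k : ℕ) {t : ℝ} (ht : 0 < t) :
    Summable fun n : ℕ => (2 * (n : ℝ) + ν) ^ k * besselMonomial ν n t :=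
  Summable.of_nonneg_of_le
    (fun n => mul_nonneg (by positivity) (besselMonomial_nonneg hν n ht))
    (fun n => pow_mul_besselMonomial_le hν k n ht)
    ((summable_besselMonomial hν (by positivity)).mul_left _)

lemma summable_mul_besselMonomial {ν : ℝ} (hν : 0 ≤ ν) {a : ℕ → ℝ} {k : ℕ}
    (ha : ∀ n, |a n| ≤ (2 * (n : ℝ) + ν) ^ k) {t : ℝ} (ht : 0 < t) :
    Summable fun n => a n * besselMonomial ν n t := by
  refine Summable.of_norm_bounded (summable_pow_mul_besselMonomial hν k ht) fun n => ?_
  rw [Real.norm_eq_abs, abs_mul, abs_of_nonneg (besselMonomial_nonneg hν n ht)]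
  exact mul_le_mul_of_nonneg_right (ha n) (besselMonomial_nonneg hν n ht)

lemma hasDerivAt_besselMonomial (ν : ℝ) (n : ℕ) {t : ℝ} (ht : 0 < t) :
    HasDerivAt (besselMonomial ν n) ((2 * n + ν) * besselMonomial ν n t / t) t := by
  have h := (((hasDerivAt_id t).div_const 2).rpow_const (p := 2 * (n : ℝ) + ν)
    (Or.inl (by simpa using ht.ne'))).div_const (Real.Gamma (ν + n + 1) * n.factorial)
  refine h.congr_deriv ?_
  simp only [id, besselMonomial]
  rw [Real.rpow_sub_one (by positivity)]
  field_simp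

lemma abs_mul_index_le {ν : ℝ} (hν : 0 ≤ ν) {a : ℕ → ℝ} {k : ℕ}
    (ha : ∀ n, |a n| ≤ (2 * (n : ℝ) + ν) ^ k) (n : ℕ) :
    |(2 * (n : ℝ) + ν) * a n| ≤ (2 * (n : ℝ) + ν) ^ (k + 1) := by
  have hp : 0 ≤ 2 * (n : ℝ) + ν := by positivity
  rw [abs_mul, abs_of_nonneg hp, pow_succ']
  exact mul_le_mul_of_nonneg_left (ha n) hp

lemma hasDerivAt_besselSeries {ν : ℝ} (hν : 0 ≤ ν) {a : ℕ → ℝ} {k : ℕ}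
    (ha : ∀ n, |a n| ≤ (2 * (n : ℝ) + ν) ^ k) {t : ℝ} (ht : 0 < t) :
    HasDerivAt (besselSeries ν a) (besselSeries ν (fun n => (2 * n + ν) * a n) t / t) t := by
  have hmem : t ∈ Set.Ioo (t / 2) (2 * t) := ⟨by linarith, by linarith⟩
  have hsum := (summable_pow_mul_besselMonomial hν (k + 1)
    (show 0 < 2 * t by positivity)).div_const (t / 2)
  have key := hasDerivAt_tsum_of_isPreconnected (𝕜 := ℝ) (F := ℝ)
    (g := fun n s => a n * besselMonomial ν n s)
    (g' := fun n s => (2 * n + ν) * a n * besselMonomial ν n s / s)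
    hsum isOpen_Ioo isPreconnected_Ioo
    (fun n y hy => by
      have hy0 : 0 < y := lt_trans (by positivity) hy.1
      refine ((hasDerivAt_besselMonomial ν n hy0).const_mul (a n)).congr_deriv ?_
      ring)
    (fun n y hy => by
      have hy0 : 0 < y := lt_trans (by positivity) hy.1
      have hf := besselMonomial_nonneg hν n hy0
      rw [Real.norm_eq_abs, abs_div, abs_mul, abs_of_pos hy0, abs_of_nonneg hf]
      have h1 := abs_mul_index_le hν ha n
      have h2 := besselMonomial_le hν n hy0 hy.2.le
      have h3 := hy.1.le
      have h4 := hf.trans h2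
      gcongr)
    hmem (summable_mul_besselMonomial hν ha ht) hmem
  rw [tsum_div_const] at key
  exact key

lemma besselMonomial_succ {ν : ℝ} (hν : 0 ≤ ν) (n : ℕ) {t : ℝ} (ht : 0 < t) :
    ((2 * ((n + 1 : ℕ) : ℝ) + ν) ^ 2 - ν ^ 2) * besselMonomial ν (n + 1) t =
      t ^ 2 * besselMonomial ν n t := by
  have hG := (Gamma_add_nat_add_one_pos hν n).ne'
  have hn : ν + n + 1 ≠ 0 := by positivity
  have hpow : (t / 2) ^ (2 * ((n + 1 : ℕ) : ℝ) + ν) =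
      (t / 2) ^ (2 * (n : ℝ) + ν) * (t / 2) ^ 2 := by
    rw [← Real.rpow_add_natCast (by positivity)]
    push_cast
    ring_nf
  have hGamma : Real.Gamma (ν + (n + 1 : ℕ) + 1) = (ν + n + 1) * Real.Gamma (ν + n + 1) := by
    rw [← Real.Gamma_add_one hn]
    push_cast
    ring_nf
  rw [besselMonomial, besselMonomial, hpow, hGamma, Nat.factorial_succ]
  push_cast
  field_simp
  ring

/-- The Bessel operator acts on a series `∑ aₙ f_{n,ν}` by the left shift of its coefficients. -/
theorem besselOp_besselSeries {ν : ℝ} (hν : 0 ≤ ν) {a : ℕ → ℝ} (ha : ∀ n, |a n| ≤ 1)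
    {t : ℝ} (ht : 0 < t) :
    besselOp ν (besselSeries ν a) t = besselSeries ν (fun n => a (n + 1)) t := by
  have ha0 : ∀ n : ℕ, |a n| ≤ (2 * (n : ℝ) + ν) ^ 0 := by simpa using ha
  have ha1 := abs_mul_index_le hν ha0
  have ha2 := abs_mul_index_le hν ha1
  have hderiv : deriv (besselSeries ν a) =ᶠ[nhds t]
      fun s => besselSeries ν (fun n => (2 * n + ν) * a n) s / s := by
    filter_upwards [lt_mem_nhds ht] with s hs
    exact (hasDerivAt_besselSeries hν ha0 hs).deriv
  have hderiv2 := ((hasDerivAt_besselSeries hν ha1 ht).fun_div (hasDerivAt_id' t) ht.ne').deriv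
  have hs0 := summable_mul_besselMonomial hν ha0 ht
  have hs2 := summable_mul_besselMonomial hν ha2 ht
  have hsum : besselSeries ν (fun n => (2 * n + ν) * ((2 * n + ν) * a n)) t -
      ν ^ 2 * besselSeries ν a t = t ^ 2 * besselSeries ν (fun n => a (n + 1)) t := by
    have hdiff := hs2.sub (hs0.mul_left (ν ^ 2))
    unfold besselSeries
    rw [← tsum_mul_left, ← hs2.tsum_sub (hs0.mul_left (ν ^ 2)), hdiff.tsum_eq_zero_add,
      ← tsum_mul_left]
    have hzero : (2 * ((0 : ℕ) : ℝ) + ν) * ((2 * ((0 : ℕ) : ℝ) + ν) * a 0) * besselMonomial ν 0 t -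
        ν ^ 2 * (a 0 * besselMonomial ν 0 t) = 0 := by
      push_cast
      ring
    rw [hzero, zero_add]
    refine tsum_congr fun n => ?_
    linear_combination a (n + 1) * besselMonomial_succ hν n ht
  rw [besselOp, hderiv.deriv_eq, hderiv2, hderiv.eq_of_nhds]
  generalize besselSeries ν (fun n => (2 * n + ν) * ((2 * n + ν) * a n)) t = S₂ at hsum ⊢
  generalize besselSeries ν (fun n => (2 * n + ν) * a n) t = S₁
  field_simp
  linear_combination hsum

/-- `L_ν Ber_ν = −Bei_ν` on `(0,∞)`. -/
theorem besselOp_kelvinBer (ν : ℝ) (hν : 0 ≤ ν) (t : ℝ) (ht : 0 < t) :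
    besselOp ν (kelvinBer ν) t = -kelvinBei ν t := by
  have h := besselOp_besselSeries hν
    (a := fun n : ℕ => Real.cos ((3 * ν + 2 * n) * π / 4)) (fun n => Real.abs_cos_le_one _) ht
  refine h.trans ?_
  rw [besselSeries, kelvinBei, ← tsum_neg]
  refine tsum_congr fun n => ?_
  have hshift : (3 * ν + 2 * ((n + 1 : ℕ) : ℝ)) * π / 4 = (3 * ν + 2 * n) * π / 4 + π / 2 := by
    push_cast
    ring
  rw [hshift, Real.cos_add_pi_div_two, neg_mul]
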